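/- Let n ≥ 3 be an integer with n ≡ 0 (mod 3), and let T be a perfect tiling subset of G for parameter n. Then m₂(e) = 1, every g ∈ G satisfies 1 ≤ m₂(g) ≤ 4, and moreover: |{g ∈ G : m₂(g) = 1}| = (4n² − 10n + 3)/3, {g ∈ G : m₂(g) = 2} = {t³ : t ∈ T} \ {e}, {g ∈ G : m₂(g) = 3} = T \ {e} (in particular each of these two sets has size 2n), and |{g ∈ G : m₂(g) = 4}| = (2n² − 2n)/3. -/

import Mathlib

/-- `T` is a perfect tiling subset of `G` for parameter `n`:
`|G| = 2n²+1`, `|T| = 2n+1`, `e ∈ T`, `T = T⁽⁻¹⁾`, and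
`T·T = 2·G + T⁽²⁾ + (2n-2)·e` in the integral group ring `ℤ[G]`. -/
def IsPerfectTilingSubset (n : ℕ) {G : Type} [CommGroup G] [Fintype G] [DecidableEq G]
    (T : Finset G) : Prop :=
  Fintype.card G = 2 * n ^ 2 + 1 ∧
  T.card = 2 * n + 1 ∧
  (1 : G) ∈ T ∧
  T = T.image (·⁻¹) ∧
  (∑ t ∈ T, MonoidAlgebra.single t (1 : ℤ)) * (∑ t ∈ T, MonoidAlgebra.single t (1 : ℤ))
    = 2 * (∑ g : G, MonoidAlgebra.single g (1 : ℤ))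
      + (∑ t ∈ T, MonoidAlgebra.single (t ^ 2) (1 : ℤ))
      + MonoidAlgebra.single (1 : G) (2 * (n : ℤ) - 2)

/-- `m₂ T g`: the number of pairs `(t₁,t₂) ∈ T × T` with `t₁·t₂² = g`,
i.e. the coefficient of `g` in the group-ring product `T·T⁽²⁾`. -/
def m2 {G : Type} [CommGroup G] [DecidableEq G] (T : Finset G) (g : G) : ℕ :=
  ((T ×ˢ T).filter (fun p => p.1 * p.2 ^ 2 = g)).card

namespace PTS

open MonoidAlgebra

set_option linter.unusedSectionVars false

variable {G : Type} [CommGroup G] [Fintype G] [DecidableEq G]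

noncomputable def S (T : Finset G) (k : ℕ) : MonoidAlgebra ℤ G :=
  ∑ t ∈ T, MonoidAlgebra.single (t ^ k) (1 : ℤ)

noncomputable def Gam (G : Type) [CommGroup G] [Fintype G] : MonoidAlgebra ℤ G :=
  ∑ g : G, MonoidAlgebra.single g (1 : ℤ)

lemma cube_sum {R ι : Type*} [CommRing R] (s : Finset ι) (f : ι → R) :
    ∃ Y, (∑ i ∈ s, f i) ^ 3 = ∑ i ∈ s, f i ^ 3 + 3 * Y := by
  classical
  induction s using Finset.induction_on with
  | empty => exact ⟨0, by simp⟩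
  | insert a s ha ih =>
    obtain ⟨Y, hY⟩ := ih
    refine ⟨Y + f a ^ 2 * (∑ i ∈ s, f i) + f a * (∑ i ∈ s, f i) ^ 2, ?_⟩
    rw [Finset.sum_insert ha, Finset.sum_insert ha]
    linear_combination hY

lemma S_cube (T : Finset G) : ∃ Y, S T 1 ^ 3 = S T 3 + 3 * Y := by
  obtain ⟨Y, hY⟩ := cube_sum T (fun t => MonoidAlgebra.single t (1 : ℤ))
  refine ⟨Y, ?_⟩
  simpa [S, MonoidAlgebra.single_pow] using hY

lemma Gam_mul_single (h : G) : Gam G * MonoidAlgebra.single h 1 = Gam G := by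
  simp only [Gam, Finset.sum_mul, MonoidAlgebra.single_mul_single, mul_one]
  exact Fintype.sum_equiv (Equiv.mulRight h) _ _ (fun _ => rfl)

lemma Gam_mul_S (T : Finset G) (k : ℕ) : Gam G * S T k = (T.card : MonoidAlgebra ℤ G) * Gam G := by
  simp [S, Finset.mul_sum, Gam_mul_single]

lemma Gam_mul_Gam : Gam G * Gam G = (Fintype.card G : MonoidAlgebra ℤ G) * Gam G := by
  conv_lhs => enter [2]; rw [Gam]
  simp [Finset.mul_sum, Gam_mul_single]

lemma coeff_Gam (g : G) : (Gam G).coeff g = 1 := by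
  simp [Gam, MonoidAlgebra.coeff_sum, Finsupp.single_apply]

lemma coeff_S (T : Finset G) (k : ℕ) (g : G) :
    (S T k).coeff g = ((T.filter (fun t => t ^ k = g)).card : ℤ) := by
  simp [S, MonoidAlgebra.coeff_sum, Finsupp.single_apply]

lemma coeff_S_inj (T : Finset G) (k : ℕ) (hk : Function.Injective (fun x : G => x ^ k)) (g : G) :
    (S T k).coeff g = if g ∈ T.image (· ^ k) then 1 else 0 := by
  rw [coeff_S]
  split_ifs with h
  · obtain ⟨t, ht, rfl⟩ := Finset.mem_image.1 h
    have : T.filter (fun s => s ^ k = t ^ k) = {t} := by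
      ext s
      simp only [Finset.mem_filter, Finset.mem_singleton]
      exact ⟨fun h => hk h.2, by rintro rfl; exact ⟨ht, rfl⟩⟩
    rw [this]; simp
  · have : T.filter (fun s => s ^ k = g) = ∅ := by
      ext s
      simp only [Finset.mem_filter, Finset.notMem_empty, iff_false]
      rintro ⟨h1, h2⟩
      exact h (Finset.mem_image.2 ⟨s, h1, h2⟩)
    rw [this]; simp

lemma coeff_SS (T : Finset G) (g : G) : (S T 1 * S T 2).coeff g = (m2 T g : ℤ) := by
  simp only [S, Finset.sum_mul_sum, ← Finset.sum_product', MonoidAlgebra.single_mul_single, m2]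
  simp [MonoidAlgebra.coeff_sum, Finsupp.single_apply]

lemma coeff_S11 (T : Finset G) (g : G) : (S T 1 * S T 1).coeff g =
    (((T ×ˢ T).filter (fun p => p.1 * p.2 = g)).card : ℤ) := by
  simp only [S, Finset.sum_mul_sum, ← Finset.sum_product', MonoidAlgebra.single_mul_single]
  simp [MonoidAlgebra.coeff_sum, Finsupp.single_apply]

lemma coeff_natCast_mul (a : ℕ) (x : MonoidAlgebra ℤ G) (g : G) :
    ((a : MonoidAlgebra ℤ G) * x).coeff g = a * x.coeff g := by
  rw [← nsmul_eq_mul, MonoidAlgebra.coeff_smul_apply, nsmul_eq_mul]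

lemma coeff_intCast_mul (a : ℤ) (x : MonoidAlgebra ℤ G) (g : G) :
    ((a : MonoidAlgebra ℤ G) * x).coeff g = a * x.coeff g := by
  rw [← zsmul_eq_mul, MonoidAlgebra.coeff_smul_apply, smul_eq_mul]

lemma eq_sum (x : MonoidAlgebra ℤ G) : x = ∑ g : G, MonoidAlgebra.single g (x.coeff g) := by
  ext g
  simp [MonoidAlgebra.coeff_sum]

lemma coeff_mul_one (x y : MonoidAlgebra ℤ G) :
    (x * y).coeff 1 = ∑ g : G, x.coeff g * y.coeff g⁻¹ := by
  conv_lhs => rw [eq_sum x, Finset.sum_mul]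
  simp [MonoidAlgebra.coeff_sum, MonoidAlgebra.coeff_single_mul_apply]

noncomputable def sq (G : Type) [CommGroup G] : MonoidAlgebra ℤ G →+* MonoidAlgebra ℤ G :=
  MonoidAlgebra.mapDomainRingHom ℤ (powMonoidHom 2 : G →* G)

lemma sq_S (T : Finset G) (k : ℕ) : sq G (S T k) = S T (2 * k) := by
  simp [sq, S, ← pow_mul, mul_comm]

lemma sq_Gam (h2 : Function.Injective (fun x : G => x ^ 2)) : sq G (Gam G) = Gam G := by
  simp only [sq, Gam, map_sum]
  refine Fintype.sum_equiv (Equiv.ofBijective _ (Finite.injective_iff_bijective.1 h2)) _ _ ?_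
  intro x; simp

lemma coeff_sq_one (h2 : Function.Injective (fun x : G => x ^ 2)) (x : MonoidAlgebra ℤ G) :
    (sq G x).coeff 1 = x.coeff 1 := by
  have := Finsupp.mapDomain_apply h2 x.coeff 1
  simp only [one_pow] at this
  exact this

lemma pow_inj (k : ℕ) (h : (Nat.card G).Coprime k) : Function.Injective (fun x : G => x ^ k) :=
  (powCoprime h).injective

lemma m2_inv (T : Finset G) (hinv : ∀ t, t ∈ T → t⁻¹ ∈ T) (g : G) : m2 T g⁻¹ = m2 T g := by
  unfold m2
  refine Finset.card_bij' (fun p _ => (p.1⁻¹, p.2⁻¹)) (fun p _ => (p.1⁻¹, p.2⁻¹)) ?_ ?_ ?_ ?_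
  · rintro ⟨a, b⟩ h
    simp only [Finset.mem_filter, Finset.mem_product] at h ⊢
    refine ⟨⟨hinv _ h.1.1, hinv _ h.1.2⟩, ?_⟩
    rw [inv_pow, ← mul_inv, h.2, inv_inv]
  · rintro ⟨a, b⟩ h
    simp only [Finset.mem_filter, Finset.mem_product] at h ⊢
    refine ⟨⟨hinv _ h.1.1, hinv _ h.1.2⟩, ?_⟩
    rw [inv_pow, ← mul_inv, h.2]
  · simp
  · simp

lemma sum_m2 (T : Finset G) : ∑ g : G, m2 T g = T.card ^ 2 := by
  have := Finset.card_eq_sum_card_fiberwise (s := T ×ˢ T) (t := (Finset.univ : Finset G))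
    (f := fun p => p.1 * p.2 ^ 2) (by simp [Set.MapsTo])
  rw [Finset.card_product] at this
  rw [pow_two, this]; rfl

lemma moment (n : ℕ) (T : Finset G) (hG : Fintype.card G = 2 * n ^ 2 + 1)
    (hc : T.card = 2 * n + 1) (h1 : (1 : G) ∈ T) (hinv : ∀ t, t ∈ T → t⁻¹ ∈ T)
    (h2 : Function.Injective (fun x : G => x ^ 2))
    (E : S T 1 * S T 1 = 2 * Gam G + S T 2 + ((2 * (n : ℤ) - 2 : ℤ) : MonoidAlgebra ℤ G)) :
    ∑ g : G, (m2 T g : ℤ) ^ 2 = 12 * n ^ 2 + 12 * n + m2 T 1 := by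
  have E2 := congrArg (sq G) E
  simp only [map_add, map_mul, map_intCast, map_ofNat, sq_S, sq_Gam h2] at E2
  have hX := coeff_mul_one (S T 1 * S T 2) (S T 1 * S T 2)
  have h4 : Function.Injective (fun x : G => x ^ 4) := by
    intro x y h
    apply h2; apply h2
    simpa [← pow_mul] using h
  simp only [coeff_SS, m2_inv T hinv, ← pow_two] at hX
  rw [← hX]
  have e1 : (S T 1 * S T 2) ^ 2 =
      ((4 * Fintype.card G + 4 * T.card + 4 * (2 * (n : ℤ) - 2) : ℤ) : MonoidAlgebra ℤ G) * Gam G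
      + sq G (S T 1 * S T 2) + ((2 * (n : ℤ) - 2 : ℤ) : MonoidAlgebra ℤ G) * (S T 2 + S T 4)
      + (((2 * (n : ℤ) - 2) ^ 2 : ℤ) : MonoidAlgebra ℤ G) * 1 := by
    rw [map_mul, sq_S, sq_S]
    have a := Gam_mul_Gam (G := G)
    have b := Gam_mul_S T 2
    have c := Gam_mul_S T 4
    norm_num at E2 ⊢
    push_cast at E E2 a b c ⊢
    linear_combination (S T 2 * S T 2) * E
      + (2 * Gam G + S T 2 + (2 * (n : MonoidAlgebra ℤ G) - 2)) * E2 + 4 * a + 2 * b + 2 * c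
  rw [e1]
  simp only [MonoidAlgebra.coeff_add, Finsupp.add_apply, coeff_intCast_mul, coeff_Gam,
    coeff_sq_one h2, coeff_SS, coeff_S_inj T 2 h2, coeff_S_inj T 4 h4, MonoidAlgebra.coeff_one_one]
  rw [if_pos (Finset.mem_image.2 ⟨1, h1, by simp⟩), if_pos (Finset.mem_image.2 ⟨1, h1, by simp⟩),
    hG, hc]
  push_cast
  ring

lemma mod3 (n : ℕ) (T : Finset G) (hc : T.card = 2 * n + 1)
    (h3 : Function.Injective (fun x : G => x ^ 3))
    (E : S T 1 * S T 1 = 2 * Gam G + S T 2 + ((2 * (n : ℤ) - 2 : ℤ) : MonoidAlgebra ℤ G)) (g : G) :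
    ∃ y : ℤ, (if g ∈ T.image (· ^ 3) then 1 else 0) + 3 * y = 2 * (2 * n + 1) + (m2 T g : ℤ) +
      (2 * n - 2) * (if g ∈ T then 1 else 0) := by
  obtain ⟨Y, hY⟩ := S_cube T
  refine ⟨Y.coeff g, ?_⟩
  have e : S T 3 + ((3 : ℤ) : MonoidAlgebra ℤ G) * Y =
      ((2 * T.card : ℤ) : MonoidAlgebra ℤ G) * Gam G
      + S T 1 * S T 2 + ((2 * (n : ℤ) - 2 : ℤ) : MonoidAlgebra ℤ G) * S T 1 := by
    have b := Gam_mul_S T 1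
    push_cast at E b ⊢
    linear_combination S T 1 * E - hY + 2 * b
  have e' := congrArg (fun x => x.coeff g) e
  have h1 : Function.Injective (fun x : G => x ^ 1) := by intro x y; simp
  simp only [MonoidAlgebra.coeff_add, Finsupp.add_apply, coeff_intCast_mul, coeff_Gam,
    coeff_SS, coeff_S_inj T 3 h3, coeff_S_inj T 1 h1, hc] at e'
  simp only [pow_one, Finset.image_id'] at e'
  rw [e']; push_cast; ring

lemma count_le (n : ℕ) (T : Finset G)
    (h2 : Function.Injective (fun x : G => x ^ 2))
    (E : S T 1 * S T 1 = 2 * Gam G + S T 2 + ((2 * (n : ℤ) - 2 : ℤ) : MonoidAlgebra ℤ G)) (g : G)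
    (hg : g ≠ 1) : ((T ×ˢ T).filter (fun p => p.1 * p.2 = g)).card ≤ 3 := by
  have e := congrArg (fun x => x.coeff g) E
  have e0 : (2 : MonoidAlgebra ℤ G) * Gam G = ((2 : ℤ) : MonoidAlgebra ℤ G) * Gam G := by simp
  simp only [e0, coeff_S11] at e
  rw [← mul_one ((2 * (n : ℤ) - 2 : ℤ) : MonoidAlgebra ℤ G)] at e
  simp only [MonoidAlgebra.coeff_add, Finsupp.add_apply, coeff_intCast_mul, coeff_Gam,
    coeff_S_inj T 2 h2] at e
  rw [MonoidAlgebra.one_def, MonoidAlgebra.coeff_single, Finsupp.single_apply, if_neg hg.symm] at e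
  split_ifs at e <;> omega

lemma m2_one (n : ℕ) (T : Finset G) (h1 : (1 : G) ∈ T) (hinv : ∀ t, t ∈ T → t⁻¹ ∈ T)
    (h2 : Function.Injective (fun x : G => x ^ 2))
    (h3 : Function.Injective (fun x : G => x ^ 3))
    (E : S T 1 * S T 1 = 2 * Gam G + S T 2 + ((2 * (n : ℤ) - 2 : ℤ) : MonoidAlgebra ℤ G)) :
    m2 T 1 = 1 := by
  have key : ∀ t ∈ T, t ^ 2 ∈ T → t = 1 := by
    intro t ht ht2
    by_contra hne
    have hle := count_le n T h2 E t hne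
    have hn2 : t ^ 2 ≠ 1 := fun h => hne (h2 (by simpa using h))
    have hn3 : t ^ 3 ≠ 1 := fun h => hne (h3 (by simpa using h))
    have hn4 : t ^ 2 ≠ t := fun h => hne (by simpa [pow_two] using h)
    have hn5 : t ^ 2 ≠ t⁻¹ := fun h => hn3 (by rw [pow_succ, h]; simp)
    have hn6 : t ≠ t⁻¹ := fun h => hn2 (by rw [pow_two]; nth_rewrite 2 [h]; simp)
    have hn7 : t⁻¹ ≠ 1 := by simpa using hne
    have hsub : ({(t, 1), (1, t), (t ^ 2, t⁻¹), (t⁻¹, t ^ 2)} : Finset (G × G)) ⊆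
        (T ×ˢ T).filter (fun p => p.1 * p.2 = t) := by
      intro p hp
      simp only [Finset.mem_insert, Finset.mem_singleton] at hp
      simp only [Finset.mem_filter, Finset.mem_product]
      rcases hp with rfl | rfl | rfl | rfl
      · simp [ht, h1]
      · simp [ht, h1]
      · exact ⟨⟨ht2, hinv t ht⟩, by simp [pow_two]⟩
      · exact ⟨⟨hinv t ht, ht2⟩, by simp [pow_two]⟩
    have hcard : ({(t, 1), (1, t), (t ^ 2, t⁻¹), (t⁻¹, t ^ 2)} : Finset (G × G)).card = 4 := by
      rw [Finset.card_insert_of_notMem, Finset.card_insert_of_notMem,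
        Finset.card_insert_of_notMem, Finset.card_singleton]
      · simp [Prod.ext_iff, hn5]
      · simp [Prod.ext_iff, hn2.symm, hn7.symm]
      · simp only [Finset.mem_insert, Finset.mem_singleton, Prod.ext_iff, not_or]
        exact ⟨fun h => hne h.1, fun h => hn4 h.1.symm, fun h => hn6 h.1⟩
    have := Finset.card_le_card hsub
    omega
  have : (T ×ˢ T).filter (fun p => p.1 * p.2 ^ 2 = 1) = {(1, 1)} := by
    ext ⟨a, b⟩
    simp only [Finset.mem_filter, Finset.mem_product, Finset.mem_singleton, Prod.mk.injEq]
    constructor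
    · rintro ⟨⟨ha, hb⟩, h⟩
      have hab : b ^ 2 = a⁻¹ := eq_inv_of_mul_eq_one_right h
      have hb1 := key b hb (hab ▸ hinv a ha)
      subst hb1
      simpa using h
    · rintro ⟨rfl, rfl⟩; simp [h1]
  rw [m2, this]; simp

end PTS


theorem stmt12 (n : ℕ) (hn : 3 ≤ n) (hmod : n % 3 = 0)
    {G : Type} [CommGroup G] [Fintype G] [DecidableEq G]
    (T : Finset G) (hT : IsPerfectTilingSubset n T) :
    m2 T 1 = 1 ∧
    (∀ g : G, 1 ≤ m2 T g ∧ m2 T g ≤ 4) ∧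
    (3 : ℤ) * ((Finset.univ.filter (fun g : G => m2 T g = 1)).card)
      = 4 * (n : ℤ) ^ 2 - 10 * n + 3 ∧
    Finset.univ.filter (fun g : G => m2 T g = 2) = (T.image (· ^ 3)).erase 1 ∧
    Finset.univ.filter (fun g : G => m2 T g = 3) = T.erase 1 ∧
    (3 : ℤ) * ((Finset.univ.filter (fun g : G => m2 T g = 4)).card)
      = 2 * (n : ℤ) ^ 2 - 2 * n := by
  obtain ⟨hG, hc, h1, hI, hE⟩ := hT
  have hinv : ∀ t, t ∈ T → t⁻¹ ∈ T := fun t ht => by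
    rw [hI]; exact Finset.mem_image_of_mem _ ht
  have E : PTS.S T 1 * PTS.S T 1 = 2 * PTS.Gam G + PTS.S T 2 +
      ((2 * (n : ℤ) - 2 : ℤ) : MonoidAlgebra ℤ G) := by
    have e : MonoidAlgebra.single (1 : G) (2 * (n : ℤ) - 2) =
        ((2 * (n : ℤ) - 2 : ℤ) : MonoidAlgebra ℤ G) := rfl
    rw [← e]
    simpa [PTS.S, PTS.Gam] using hE
  have h2 : Function.Injective (fun x : G => x ^ 2) := by
    apply PTS.pow_inj
    rw [Nat.card_eq_fintype_card, hG]
    simp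
  have h3 : Function.Injective (fun x : G => x ^ 3) := by
    apply PTS.pow_inj
    rw [Nat.card_eq_fintype_card, hG]
    obtain ⟨k, rfl⟩ : 3 ∣ n := Nat.dvd_of_mod_eq_zero hmod
    rw [Nat.coprime_comm, Nat.Prime.coprime_iff_not_dvd Nat.prime_three]
    intro h
    have : 3 ∣ 2 * (3 * k) ^ 2 := ⟨2 * 3 * k ^ 2, by ring⟩
    omega
  have hm1 := PTS.m2_one n T h1 hinv h2 h3 E
  have hmom := PTS.moment n T hG hc h1 hinv h2 E
  have hsum : ∑ g : G, (m2 T g : ℤ) = (2 * n + 1) ^ 2 := by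
    have := PTS.sum_m2 T
    rw [hc] at this
    exact_mod_cast this
  have hmod3 := PTS.mod3 n T hc h3 E
  have h1' : (1 : G) ∈ T.image (· ^ 3) := Finset.mem_image.2 ⟨1, h1, by simp⟩
  set U := T.image (· ^ 3) with hU
  have hUc : U.card = 2 * n + 1 := by rw [hU, Finset.card_image_of_injective _ h3, hc]
  have cA : (T.erase 1).card = 2 * n := by rw [Finset.card_erase_of_mem h1, hc]; rfl
  have cB : (U.erase 1).card = 2 * n := by rw [Finset.card_erase_of_mem h1', hUc]; rfl
  let f : G → ℤ := fun g => ((m2 T g : ℤ) - 1) * ((m2 T g : ℤ) - 4)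
    + (if g ∈ T.erase 1 then 2 else 0) + (if g ∈ U.erase 1 then 2 else 0)
  have hquad : ∀ m : ℤ, m ≤ 0 ∨ m = 1 ∨ m = 2 ∨ m = 3 ∨ m = 4 ∨ 5 ≤ m := by intro m; omega
  have cases : ∀ g : G, f g ≥ 0 ∧ (f g = 0 →
      (g ∈ T.erase 1 ∧ g ∉ U.erase 1 ∧ m2 T g = 3) ∨
      (g ∉ T.erase 1 ∧ g ∈ U.erase 1 ∧ m2 T g = 2) ∨
      (g ∉ T.erase 1 ∧ g ∉ U.erase 1 ∧ (m2 T g = 1 ∨ m2 T g = 4))) := by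
    intro g
    obtain ⟨y, hy⟩ := hmod3 g
    obtain ⟨k, rfl⟩ : 3 ∣ n := Nat.dvd_of_mod_eq_zero hmod
    by_cases hg : g = 1
    · subst hg
      simp [f, hm1]
    simp only [f, Finset.mem_erase, ne_eq, hg, not_false_eq_true, true_and]
    have hsmall : (m2 T g = 0 ∨ m2 T g = 1 ∨ m2 T g = 2 ∨ m2 T g = 3 ∨ m2 T g = 4) ∨
        5 ≤ m2 T g := by omega
    by_cases ha : g ∈ T <;> by_cases hb : g ∈ U <;>
      simp only [ha, hb, if_true, if_false, mul_one, mul_zero] at hy ⊢ <;>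
      push_cast at hy <;>
      rcases hsmall with (h | h | h | h | h) | h
    all_goals first
      | (rw [h] at hy ⊢; norm_num; done)
      | (exfalso; rw [h] at hy; push_cast at hy; omega)
      | (have h' : (5 : ℤ) ≤ m2 T g := by exact_mod_cast h
         have hp : ((m2 T g : ℤ) - 1) * ((m2 T g : ℤ) - 4) ≥ 4 := by nlinarith
         exact ⟨by linarith, fun h0 => by exfalso; linarith⟩)
  have hind : ∀ A : Finset G, ∑ g : G, (if g ∈ A then (2 : ℤ) else 0) = 2 * A.card := by
    intro A; simp [mul_comm]
  have hcard : ∑ g : G, (1 : ℤ) = 2 * n ^ 2 + 1 := by simp [hG]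
  have hf0 : ∑ g : G, f g = 0 := by
    have : ∑ g : G, f g = ∑ g : G, (m2 T g : ℤ) ^ 2 - 5 * ∑ g : G, (m2 T g : ℤ)
        + 4 * ∑ g : G, (1 : ℤ) + ∑ g : G, (if g ∈ T.erase 1 then (2 : ℤ) else 0)
        + ∑ g : G, (if g ∈ U.erase 1 then (2 : ℤ) else 0) := by
      rw [Finset.mul_sum, Finset.mul_sum, ← Finset.sum_sub_distrib, ← Finset.sum_add_distrib,
        ← Finset.sum_add_distrib, ← Finset.sum_add_distrib]
      refine Finset.sum_congr rfl fun g _ => ?_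
      simp only [f]; ring
    rw [this, hind, hind, hmom, hsum, hcard, cA, cB, hm1]
    push_cast; ring
  have hfz : ∀ g, f g = 0 := fun g =>
    (Finset.sum_eq_zero_iff_of_nonneg (fun g _ => (cases g).1)).1 hf0 g (Finset.mem_univ g)
  have main := fun g => (cases g).2 (hfz g)
  have s2 : Finset.univ.filter (fun g : G => m2 T g = 2) = U.erase 1 := by
    ext g
    simp only [Finset.mem_filter, Finset.mem_univ, true_and]
    rcases main g with ⟨a, b, c⟩ | ⟨a, b, c⟩ | ⟨a, b, c | c⟩ <;> simp only [c, b] <;> norm_num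
  have s3 : Finset.univ.filter (fun g : G => m2 T g = 3) = T.erase 1 := by
    ext g
    simp only [Finset.mem_filter, Finset.mem_univ, true_and]
    rcases main g with ⟨a, b, c⟩ | ⟨a, b, c⟩ | ⟨a, b, c | c⟩ <;> simp only [c, a] <;> norm_num
  have hI : ∀ k : ℕ, ((Finset.univ.filter (fun g : G => m2 T g = k)).card : ℤ) =
      ∑ g : G, (if m2 T g = k then (1 : ℤ) else 0) := by intro k; simp
  have c2 := hI 2
  have c3 := hI 3
  rw [s2, cB] at c2
  rw [s3, cA] at c3
  have t0 : ∑ g : G, (1 : ℤ) = (∑ g : G, (if m2 T g = 1 then (1 : ℤ) else 0))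
      + (∑ g : G, (if m2 T g = 2 then (1 : ℤ) else 0))
      + (∑ g : G, (if m2 T g = 3 then (1 : ℤ) else 0))
      + (∑ g : G, (if m2 T g = 4 then (1 : ℤ) else 0)) := by
    rw [← Finset.sum_add_distrib, ← Finset.sum_add_distrib, ← Finset.sum_add_distrib]
    refine Finset.sum_congr rfl fun g _ => ?_
    rcases main g with ⟨a, b, c⟩ | ⟨a, b, c⟩ | ⟨a, b, c | c⟩ <;> simp [c]
  have t1 : ∑ g : G, (m2 T g : ℤ) = (∑ g : G, (if m2 T g = 1 then (1 : ℤ) else 0))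
      + 2 * (∑ g : G, (if m2 T g = 2 then (1 : ℤ) else 0))
      + 3 * (∑ g : G, (if m2 T g = 3 then (1 : ℤ) else 0))
      + 4 * (∑ g : G, (if m2 T g = 4 then (1 : ℤ) else 0)) := by
    rw [Finset.mul_sum, Finset.mul_sum, Finset.mul_sum,
      ← Finset.sum_add_distrib, ← Finset.sum_add_distrib, ← Finset.sum_add_distrib]
    refine Finset.sum_congr rfl fun g _ => ?_
    rcases main g with ⟨a, b, c⟩ | ⟨a, b, c⟩ | ⟨a, b, c | c⟩ <;> simp [c]
  rw [hcard, ← c2, ← c3] at t0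
  rw [hsum, ← c2, ← c3] at t1
  push_cast at t0 t1
  refine ⟨hm1, ?_, ?_, s2, s3, ?_⟩
  · intro g
    rcases main g with ⟨a, b, c⟩ | ⟨a, b, c⟩ | ⟨a, b, c | c⟩ <;> omega
  · rw [hI 1]; linarith
  · rw [hI 4]; linarith
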